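/- (Total variation contraction for kernels with densities bounded below.) Let M be a compact Borel subset of ℝ^d with vol(M) > 0, and let K : M × M → ℝ be a jointly measurable function with ∫_M K(x, z) dz = 1 for every x ∈ M and K(x, z) ≥ c₋ > 0 for all x, z ∈ M. Let P be the Markov kernel on M defined by P(x, A) = ∫_A K(x, z) dz, and set θ = 1 − vol(M) · c₋ (so 0 ≤ θ < 1). Then for any two probability measures μ, ν on M and every t ≥ 1, ‖μ P^t − ν P^t‖_TV ≤ θ^t · ‖μ − ν‖_TV, where ‖σ‖_TV denotes the total variation norm |σ|(M) of a signed measure σ. -/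

import Mathlib

open MeasureTheory Set
open scoped ENNReal

/-- The Markov kernel with transition density `K` with respect to Lebesgue measure
restricted to `M`:  `P(x, A) = ∫_{A ∩ M} K(x, z) dz`. -/
noncomputable def densityKernel {d : ℕ} (M : Set (EuclideanSpace ℝ (Fin d)))
    (K : EuclideanSpace ℝ (Fin d) → EuclideanSpace ℝ (Fin d) → ℝ)
    (x : EuclideanSpace ℝ (Fin d)) : Measure (EuclideanSpace ℝ (Fin d)) :=
  (volume.restrict M).withDensity (fun z => ENNReal.ofReal (K x z))

/-- The distribution `μ P^t` after `t` steps of the chain with kernel `P` started from `μ`. -/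
noncomputable def iterMeas {X : Type*} [MeasurableSpace X]
    (P : X → Measure X) (t : ℕ) (μ : Measure X) : Measure X :=
  (fun ν => ν.bind P)^[t] μ

/-- The total variation norm `‖μ − ν‖_TV = |μ − ν|(M)`, expressed via the Jordan
decomposition `|μ − ν| = (μ − ν) + (ν − μ)` (truncated subtraction of measures). -/
noncomputable def tvNormOn {X : Type*} [MeasurableSpace X] (M : Set X)
    (μ ν : Measure X) : ℝ :=
  ((μ - ν) M + (ν - μ) M).toReal

namespace MeasureTheory.Measure

variable {X : Type*} [MeasurableSpace X]

theorem le_sub_add_self (μ ν : Measure X) [IsFiniteMeasure μ] [IsFiniteMeasure ν] :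
    μ ≤ μ - ν + ν := by
  obtain ⟨s, hs⟩ := exists_isHahnDecomposition μ ν
  calc μ = μ.restrict s + μ.restrict sᶜ := (restrict_add_restrict_compl hs.measurableSet).symm
    _ ≤ ν.restrict s + μ.restrict sᶜ := by gcongr ?_ + _; exact hs.le_on
    _ = ν.restrict s + ((μ - ν).restrict sᶜ + ν.restrict sᶜ) := by
        rw [restrict_sub_eq_restrict_sub_restrict hs.measurableSet.compl,
          sub_add_cancel_of_le hs.ge_on_compl]
    _ = (μ - ν).restrict sᶜ + ν := by
        rw [add_left_comm, restrict_add_restrict_compl hs.measurableSet]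
    _ ≤ μ - ν + ν := by gcongr; exact restrict_le_self

theorem bind_eq_add_bind {P Q : X → Measure X} (hP : Measurable P) (hQ : Measurable Q)
    {m μ : Measure X} [IsProbabilityMeasure μ] (h : ∀ᵐ x ∂μ, P x = m + Q x) :
    μ.bind P = m + μ.bind Q := by
  ext s hs
  rw [add_apply, bind_apply hs hP.aemeasurable, bind_apply hs hQ.aemeasurable]
  calc ∫⁻ x, P x s ∂μ = ∫⁻ x, (m s + Q x s) ∂μ :=
        lintegral_congr_ae (h.mono fun x hx => by simp [hx])
    _ = m s + ∫⁻ x, Q x s ∂μ := by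
        rw [lintegral_add_left measurable_const]; simp

theorem bind_mono_left {Q : X → Measure X} (hQ : Measurable Q) {μ ν : Measure X} (h : μ ≤ ν) :
    μ.bind Q ≤ ν.bind Q := by
  refine le_iff.2 fun s hs => ?_
  rw [bind_apply hs hQ.aemeasurable, bind_apply hs hQ.aemeasurable]
  exact lintegral_mono' h le_rfl

theorem add_bind {Q : X → Measure X} (hQ : Measurable Q) (μ ν : Measure X) :
    (μ + ν).bind Q = μ.bind Q + ν.bind Q := by
  ext s hs
  simp only [add_apply, bind_apply hs hQ.aemeasurable, lintegral_add_measure]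

/-- Minorization: a part `m` of the kernel that does not depend on the starting point cancels. -/
theorem bind_sub_bind_le {P Q : X → Measure X} (hP : Measurable P) (hQ : Measurable Q)
    {m μ ν : Measure X} [IsProbabilityMeasure μ] [IsProbabilityMeasure ν]
    (hμ : ∀ᵐ x ∂μ, P x = m + Q x) (hν : ∀ᵐ x ∂ν, P x = m + Q x) :
    μ.bind P - ν.bind P ≤ (μ - ν).bind Q := by
  refine sub_le_of_le_add ?_
  rw [bind_eq_add_bind hP hQ hμ, bind_eq_add_bind hP hQ hν]
  have h : μ.bind Q ≤ (μ - ν).bind Q + ν.bind Q := by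
    rw [← add_bind hQ]
    exact bind_mono_left hQ (le_sub_add_self μ ν)
  calc m + μ.bind Q ≤ m + ((μ - ν).bind Q + ν.bind Q) := by gcongr
    _ = (μ - ν).bind Q + (m + ν.bind Q) := by abel

theorem bind_sub_bind_apply_le {P Q : X → Measure X} (hP : Measurable P) (hQ : Measurable Q)
    {M : Set X} (hM : MeasurableSet M) {m μ ν : Measure X} {θ : ℝ≥0∞}
    [IsProbabilityMeasure μ] [IsProbabilityMeasure ν]
    (hμM : ∀ᵐ x ∂μ, x ∈ M) (hνM : ∀ᵐ x ∂ν, x ∈ M)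
    (hPQ : ∀ x ∈ M, P x = m + Q x) (hθ : ∀ x ∈ M, Q x M ≤ θ) :
    (μ.bind P - ν.bind P) M ≤ θ * (μ - ν) M := by
  have hle : μ - ν ≤ μ := sub_le
  have hsub : ∀ᵐ x ∂(μ - ν), x ∈ M := hle.absolutelyContinuous.ae_le hμM
  calc (μ.bind P - ν.bind P) M ≤ (μ - ν).bind Q M :=
        bind_sub_bind_le hP hQ (hμM.mono hPQ) (hνM.mono hPQ) M
    _ = ∫⁻ x, Q x M ∂(μ - ν) := bind_apply hM hQ.aemeasurable
    _ ≤ ∫⁻ _, θ ∂(μ - ν) := lintegral_mono_ae (hsub.mono hθ)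
    _ = θ * (μ - ν) M := by
        rw [lintegral_const, measure_eq_measure_of_null_sdiff (subset_univ M)]
        simpa [← compl_eq_univ_sdiff] using mem_ae_iff.1 hsub

theorem measurable_withDensity_of_uncurry {Y : Type*} [MeasurableSpace Y] (m : Measure Y)
    [SFinite m] {f : X → Y → ℝ≥0∞} (hf : Measurable (Function.uncurry f)) :
    Measurable fun x => m.withDensity (f x) := by
  refine measurable_of_measurable_coe _ fun s hs => ?_
  simp only [withDensity_apply _ hs]
  exact hf.lintegral_prod_right'

end MeasureTheory.Measure

theorem tvNormOn_bind_le {X : Type*} [MeasurableSpace X] {P Q : X → Measure X}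
    (hP : Measurable P) (hQ : Measurable Q) {M : Set X} (hM : MeasurableSet M)
    {m μ ν : Measure X} {θ : ℝ≥0∞} [IsProbabilityMeasure μ] [IsProbabilityMeasure ν]
    (hμM : ∀ᵐ x ∂μ, x ∈ M) (hνM : ∀ᵐ x ∂ν, x ∈ M)
    (hPQ : ∀ x ∈ M, P x = m + Q x) (hθ : ∀ x ∈ M, Q x M ≤ θ) (hθ_top : θ ≠ ∞) :
    tvNormOn M (μ.bind P) (ν.bind P) ≤ θ.toReal * tvNormOn M μ ν := by
  have hfin (μ ν : Measure X) [IsFiniteMeasure μ] : (μ - ν) M ≠ ∞ :=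
    ((Measure.sub_le (μ := μ) (ν := ν) M).trans_lt (measure_lt_top μ M)).ne
  rw [tvNormOn, tvNormOn, ← ENNReal.toReal_mul, mul_add]
  refine ENNReal.toReal_mono (by finiteness [hfin μ ν, hfin ν μ]) (add_le_add ?_ ?_)
  · exact Measure.bind_sub_bind_apply_le hP hQ hM hμM hνM hPQ hθ
  · exact Measure.bind_sub_bind_apply_le hP hQ hM hνM hμM hPQ hθ

theorem tvNormOn_iterMeas_le {X : Type*} [MeasurableSpace X] {P Q : X → Measure X}
    (hP : Measurable P) (hQ : Measurable Q) {M : Set X} (hM : MeasurableSet M)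
    {m : Measure X} {θ : ℝ≥0∞} (hprob : ∀ x ∈ M, IsProbabilityMeasure (P x))
    (hPM : ∀ x ∈ M, P x Mᶜ = 0) (hPQ : ∀ x ∈ M, P x = m + Q x)
    (hθ : ∀ x ∈ M, Q x M ≤ θ) (hθ_top : θ ≠ ∞)
    (μ ν : Measure X) [IsProbabilityMeasure μ] [IsProbabilityMeasure ν]
    (hμM : ∀ᵐ x ∂μ, x ∈ M) (hνM : ∀ᵐ x ∂ν, x ∈ M) (t : ℕ) :
    tvNormOn M (iterMeas P t μ) (iterMeas P t ν) ≤ θ.toReal ^ t * tvNormOn M μ ν := by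
  have hinv (μ : Measure X) [IsProbabilityMeasure μ] (hμM : ∀ᵐ x ∂μ, x ∈ M) (t : ℕ) :
      IsProbabilityMeasure (iterMeas P t μ) ∧ ∀ᵐ x ∂(iterMeas P t μ), x ∈ M := by
    induction t with
    | zero => exact ⟨‹_›, hμM⟩
    | succ t ih =>
      obtain ⟨_, ih⟩ := ih
      rw [iterMeas, Function.iterate_succ_apply', ← iterMeas]
      refine ⟨isProbabilityMeasure_bind hP.aemeasurable (ih.mono hprob), ?_⟩
      rw [ae_iff, ← compl_def, Measure.bind_apply hM.compl hP.aemeasurable,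
        lintegral_congr_ae (ih.mono hPM), lintegral_zero]
  induction t with
  | zero => simp [iterMeas]
  | succ t ih =>
    obtain ⟨_, hμt⟩ := hinv μ hμM t
    obtain ⟨_, hνt⟩ := hinv ν hνM t
    have hstep := tvNormOn_bind_le hP hQ hM hμt hνt hPQ hθ hθ_top
    rw [iterMeas, iterMeas, Function.iterate_succ_apply', Function.iterate_succ_apply',
      ← iterMeas, ← iterMeas, pow_succ', mul_assoc]
    exact hstep.trans (by gcongr)

/-- **Total variation contraction for kernels with densities bounded below.**
If `K` is a transition density on a compact `M ⊆ ℝ^d` with `∫_M K(x,z) dz = 1` and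
`K ≥ cmin > 0`, then with `θ = 1 − vol(M) cmin`, for any two probability measures `μ, ν` on `M`
and all `t ≥ 1`, `‖μP^t − νP^t‖_TV ≤ θ^t ‖μ − ν‖_TV`. -/
theorem tv_contraction_of_density_bounded_below
    (d : ℕ) (M : Set (EuclideanSpace ℝ (Fin d)))
    (hMcompact : IsCompact M) (hMmeas : MeasurableSet M) (hMvol : 0 < volume M)
    (K : EuclideanSpace ℝ (Fin d) → EuclideanSpace ℝ (Fin d) → ℝ)
    (hKmeas : Measurable (Function.uncurry K))
    (cmin : ℝ) (hc : 0 < cmin)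
    (hKlb : ∀ x ∈ M, ∀ z ∈ M, cmin ≤ K x z)
    (hKint : ∀ x ∈ M, ∫ z in M, K x z = 1) :
    ∀ μ ν : Measure (EuclideanSpace ℝ (Fin d)),
      IsProbabilityMeasure μ → μ M = 1 → IsProbabilityMeasure ν → ν M = 1 →
      ∀ t : ℕ, 1 ≤ t →
        tvNormOn M (iterMeas (densityKernel M K) t μ) (iterMeas (densityKernel M K) t ν) ≤
          (1 - (volume M).toReal * cmin) ^ t * tvNormOn M μ ν := by
  intro μ ν _ hμM _ hνM t _
  have hvol : volume M ≠ ∞ := hMcompact.measure_lt_top.ne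
  set c := ENNReal.ofReal cmin
  have hlb : ∀ x ∈ M, ∀ᵐ z ∂volume.restrict M, c ≤ ENNReal.ofReal (K x z) := fun x hx =>
    (ae_restrict_mem hMmeas).mono fun z hz => ENNReal.ofReal_le_ofReal (hKlb x hx z hz)
  have hlint : ∀ x ∈ M, ∫⁻ z in M, ENNReal.ofReal (K x z) = 1 := fun x hx => by
    rw [← ofReal_integral_eq_lintegral_ofReal, hKint x hx, ENNReal.ofReal_one]
    · exact Integrable.of_integral_ne_zero (by simp [hKint x hx])
    · exact (ae_restrict_mem hMmeas).mono fun z hz => hc.le.trans (hKlb x hx z hz)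
  have hKofReal : Measurable (Function.uncurry fun x z => ENNReal.ofReal (K x z)) :=
    hKmeas.ennreal_ofReal
  set Q : EuclideanSpace ℝ (Fin d) → Measure (EuclideanSpace ℝ (Fin d)) := fun x =>
    (volume.restrict M).withDensity fun z => ENNReal.ofReal (K x z) - c
  have hcvol : c * volume M ≤ 1 := by
    obtain ⟨x, hx⟩ := nonempty_of_measure_ne_zero hMvol.ne'
    rw [← hlint x hx, ← setLIntegral_const]
    exact lintegral_mono_ae (hlb x hx)
  have hθ : (1 - c * volume M).toReal = 1 - (volume M).toReal * cmin := by
    rw [ENNReal.toReal_sub_of_le hcvol ENNReal.one_ne_top, ENNReal.toReal_mul,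
      ENNReal.toReal_ofReal hc.le, ENNReal.toReal_one, mul_comm]
  rw [← hθ]
  refine tvNormOn_iterMeas_le (Q := Q) (m := (volume.restrict M).withDensity fun _ => c)
    (Measure.measurable_withDensity_of_uncurry _ hKofReal)
    (Measure.measurable_withDensity_of_uncurry _ (hKofReal.sub measurable_const)) hMmeas
    (fun x hx => ⟨?_⟩) (fun x hx => ?_) (fun x hx => ?_) (fun x hx => ?_) (by finiteness) μ ν
    ((mem_ae_iff_prob_eq_one hMmeas).2 hμM) ((mem_ae_iff_prob_eq_one hMmeas).2 hνM) t
  · change (volume.restrict M).withDensity _ univ = 1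
    rw [withDensity_apply _ .univ, Measure.restrict_univ, hlint x hx]
  · exact withDensity_absolutelyContinuous _ _ (by simp [Measure.restrict_apply hMmeas.compl])
  · change (volume.restrict M).withDensity _ = _ + (volume.restrict M).withDensity _
    rw [← withDensity_add_left measurable_const]
    exact withDensity_congr_ae ((hlb x hx).mono fun z hz => (add_tsub_cancel_of_le hz).symm)
  · rw [withDensity_apply _ hMmeas, Measure.restrict_restrict hMmeas, inter_self,
      lintegral_sub measurable_const (by simpa using ENNReal.mul_ne_top ENNReal.ofReal_ne_top hvol)
        (hlb x hx), hlint x hx, setLIntegral_const]
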